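/- Let K = ℚ(√d) be a quadratic field ramified at exactly r primes (including the infinite-free convention: the ramified primes are the prime divisors of d, plus 2 if d ≡ 3 mod 4). Then the 2-torsion subgroup of the narrow class group Cl₊(K) is isomorphic to (ℤ/2)^(r-1). -/

import Mathlib

open NumberField

/-- The subgroup of totally positive elements of `Kˣ`: those `x` with `φ x > 0` for
every real embedding `φ : K →+* ℝ`. -/
def totallyPositiveUnits (K : Type*) [Field K] : Subgroup Kˣ where
  carrier := {x | ∀ φ : K →+* ℝ, 0 < φ x}
  one_mem' := fun φ => by simp
  mul_mem' := by
    intro a b ha hb φ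
    rw [Units.val_mul, map_mul]
    exact mul_pos (ha φ) (hb φ)
  inv_mem' := by
    intro a ha φ
    rw [Units.val_inv_eq_inv_val, map_inv₀]
    exact inv_pos.2 (ha φ)

/-- The narrow class group `Cl₊(K)`: fractional ideals of `𝓞 K` modulo principal
fractional ideals generated by totally positive elements. -/
noncomputable def narrowClassGroup (K : Type*) [Field K] [NumberField K] : Type _ :=
  (FractionalIdeal (nonZeroDivisors (𝓞 K)) K)ˣ ⧸
    Subgroup.map (toPrincipalIdeal (𝓞 K) K) (totallyPositiveUnits K)

noncomputable instance (K : Type*) [Field K] [NumberField K] :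
    CommGroup (narrowClassGroup K) :=
  inferInstanceAs (CommGroup ((FractionalIdeal (nonZeroDivisors (𝓞 K)) K)ˣ ⧸
    Subgroup.map (toPrincipalIdeal (𝓞 K) K) (totallyPositiveUnits K)))

/-- The 2-torsion subgroup `G[2]` of a commutative group `G`. -/
def twoTorsion (G : Type*) [CommGroup G] : Subgroup G where
  carrier := {x | x ^ 2 = 1}
  one_mem' := by simp
  mul_mem' := by
    intro a b ha hb
    simp only [Set.mem_setOf_eq] at *
    rw [mul_pow, ha, hb, one_mul]
  inv_mem' := by
    intro a ha
    simp only [Set.mem_setOf_eq] at *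
    rw [inv_pow, ha, inv_one]

/-- A rational prime `p` is ramified in `K` if `p𝓞 K` is the square of a prime ideal. -/
def IsRamifiedIn (K : Type*) [Field K] [NumberField K] (p : ℕ) : Prop :=
  p.Prime ∧ ∃ P : Ideal (𝓞 K), P.IsPrime ∧ Ideal.span {(p : 𝓞 K)} = P ^ 2

section Galois

variable {K : Type*} [Field K] [NumberField K]

theorem isGalois_rat_of_finrank_eq_two (hK : Module.finrank ℚ K = 2) : IsGalois ℚ K :=
  have : Algebra.IsQuadraticExtension ℚ K := ⟨hK⟩
  inferInstance

theorem card_gal_of_finrank_eq_two (hK : Module.finrank ℚ K = 2) : Nat.card Gal(K/ℚ) = 2 := by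
  have := isGalois_rat_of_finrank_eq_two hK
  rw [IsGalois.card_aut_eq_finrank, hK]

theorem exists_gal_ne_one (hK : Module.finrank ℚ K = 2) : ∃ σ : Gal(K/ℚ), σ ≠ 1 := by
  have : Nontrivial Gal(K/ℚ) :=
    Finite.one_lt_card_iff_nontrivial.mp (by rw [card_gal_of_finrank_eq_two hK]; norm_num)
  exact exists_ne 1

theorem gal_eq_one_or_eq (hK : Module.finrank ℚ K = 2) {σ : Gal(K/ℚ)} (hσ : σ ≠ 1)
    (τ : Gal(K/ℚ)) : τ = 1 ∨ τ = σ := by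
  obtain ⟨y, -, hy⟩ := (Nat.card_eq_two_iff' (1 : Gal(K/ℚ))).mp (card_gal_of_finrank_eq_two hK)
  by_cases hτ : τ = 1
  · exact .inl hτ
  · exact .inr ((hy τ hτ).trans (hy σ hσ).symm)

theorem gal_mul_self (hK : Module.finrank ℚ K = 2) (σ : Gal(K/ℚ)) : σ * σ = 1 := by
  rw [← pow_two, ← card_gal_of_finrank_eq_two hK, pow_card_eq_one']

theorem gal_apply_apply (hK : Module.finrank ℚ K = 2) (σ : Gal(K/ℚ)) (x : K) : σ (σ x) = x := by
  simpa using DFunLike.congr_fun (gal_mul_self hK σ) x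

theorem exists_algebraMap_eq_of_gal_apply_eq (hK : Module.finrank ℚ K = 2) {σ : Gal(K/ℚ)}
    (hσ : σ ≠ 1) {x : K} (hx : σ x = x) : ∃ q : ℚ, algebraMap ℚ K q = x := by
  have := isGalois_rat_of_finrank_eq_two hK
  refine IntermediateField.mem_bot.mp ((IsGalois.mem_bot_iff_fixed x).mpr fun τ => ?_)
  rcases gal_eq_one_or_eq hK hσ τ with rfl | rfl
  · rfl
  · exact hx

theorem exists_gal_apply_eq_neg {σ : Gal(K/ℚ)} (hK : Module.finrank ℚ K = 2) (hσ : σ ≠ 1) :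
    ∃ x : K, x ≠ 0 ∧ σ x = -x := by
  obtain ⟨y, hy⟩ : ∃ y : K, σ y ≠ y := by
    by_contra! h
    exact hσ (AlgEquiv.ext h)
  exact ⟨y - σ y, sub_ne_zero.mpr hy.symm, by rw [map_sub, gal_apply_apply hK]; ring⟩

/-- The endomorphism `x ↦ x / σ x` of `Kˣ`. -/
noncomputable def divGal (σ : Gal(K/ℚ)) : Kˣ →* Kˣ :=
  MonoidHom.id Kˣ / Units.map (σ : K →* K)

theorem divGal_eq_iff {σ : Gal(K/ℚ)} {x y : Kˣ} : divGal σ x = y ↔ (x : K) = y * σ x := by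
  simp [divGal, div_eq_iff_eq_mul, Units.ext_iff]

theorem gal_mem_totallyPositiveUnits {x : Kˣ} (hx : x ∈ totallyPositiveUnits K) (σ : Gal(K/ℚ)) :
    Units.map (σ : K →* K) x ∈ totallyPositiveUnits K :=
  fun φ => hx (φ.comp (σ : K →+* K))

theorem algebraMap_mem_totallyPositiveUnits {q : ℚˣ} (hq : 0 < (q : ℚ)) :
    Units.map (algebraMap ℚ K : ℚ →* K) q ∈ totallyPositiveUnits K := by
  intro φ
  simpa using hq

/-- The norm of a totally positive element of a quadratic field is positive. -/
theorem pos_of_mul_gal_eq (hK : Module.finrank ℚ K = 2) {σ : Gal(K/ℚ)} (hσ : σ ≠ 1) {x : Kˣ}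
    (hx : x ∈ totallyPositiveUnits K) {q : ℚ} (hq : algebraMap ℚ K q = x * σ x) : 0 < q := by
  have := isGalois_rat_of_finrank_eq_two hK
  by_cases h : ∃ φ : K →+* ℝ, True
  · obtain ⟨φ, -⟩ := h
    have h1 := congrArg φ hq
    rw [map_mul, eq_ratCast, map_ratCast] at h1
    have : (0 : ℝ) < q := h1 ▸ mul_pos (hx φ) (hx (φ.comp (σ : K →+* K)))
    exact_mod_cast this
  · push Not at h
    obtain ⟨φ⟩ : Nonempty (K →+* ℂ) := inferInstance
    obtain ⟨τ, hτ⟩ := NumberField.ComplexEmbedding.exists_comp_symm_eq_of_comp_eq (k := ℚ) φ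
      (ComplexEmbedding.conjugate φ) (Subsingleton.elim _ _)
    rcases gal_eq_one_or_eq hK hσ τ.symm with h1 | h1
    · have hreal : ComplexEmbedding.IsReal φ := by
        rw [ComplexEmbedding.isReal_iff, ← hτ, h1]
        rfl
      exact (h hreal.embedding).elim
    · have h2 := DFunLike.congr_fun hτ (x : K)
      rw [h1] at h2
      have h3 : φ (σ x) = (starRingEnd ℂ) (φ x) := h2
      have h4 := congrArg φ hq
      rw [map_mul, h3, Complex.mul_conj, eq_ratCast, map_ratCast] at h4
      have h5 : ((q : ℝ)) = Complex.normSq (φ x) := by exact_mod_cast h4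
      have : (0 : ℝ) < q := h5 ▸ Complex.normSq_pos.mpr ((map_ne_zero φ).mpr x.ne_zero)
      exact_mod_cast this

/-- Hilbert 90 for totally positive elements. -/
theorem exists_divGal_eq (hK : Module.finrank ℚ K = 2) {σ : Gal(K/ℚ)} (hσ : σ ≠ 1) {x : Kˣ}
    (hx : x ∈ totallyPositiveUnits K) (hn : (x : K) * σ x = 1) :
    ∃ a ∈ totallyPositiveUnits K, divGal σ a = x := by
  by_cases h : (x : K) = -1
  · obtain ⟨y, hy, hσy⟩ := exists_gal_apply_eq_neg hK hσ
    refine ⟨Units.mk0 y hy, fun φ => ?_, ?_⟩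
    · have := hx φ
      rw [h, map_neg, map_one] at this
      linarith
    · rw [divGal_eq_iff, h]
      simp [hσy]
  · refine ⟨Units.mk0 (1 + x) fun h0 => h (by linear_combination h0), fun φ => ?_, ?_⟩
    · have := hx φ
      simp only [Units.val_mk0, map_add, map_one]
      positivity
    · rw [divGal_eq_iff]
      simp only [Units.val_mk0, map_add, map_one]
      linear_combination -hn

end Galois

section Ideals

open scoped Pointwise nonZeroDivisors

open IsDedekindDomain FractionalIdeal

variable {K : Type*} [Field K] [NumberField K]

theorem smul_span_natCast (σ : Gal(K/ℚ)) (n : ℕ) :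
    σ • Ideal.span {(n : 𝓞 K)} = Ideal.span {(n : 𝓞 K)} := by
  rw [Ideal.pointwise_smul_def, Ideal.map_span, Set.image_singleton, map_natCast]

theorem span_natCast_ne_bot {n : ℕ} (hn : n ≠ 0) : Ideal.span {(n : 𝓞 K)} ≠ ⊥ := by
  simpa using hn

theorem under_int_eq_span {S : Type*} [CommRing S] {p : ℕ} (hp : p.Prime) {P : Ideal S}
    [P.IsPrime] (hpP : (p : S) ∈ P) : P.under ℤ = Ideal.span {(p : ℤ)} := by
  have hp' := Nat.prime_iff_prime_int.mp hp
  have : (Ideal.span {(p : ℤ)}).IsMaximal :=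
    ((Ideal.span_singleton_prime hp'.ne_zero).mpr hp').isMaximal (by simpa using hp.ne_zero)
  refine (this.eq_of_le (Ideal.IsPrime.ne_top inferInstance) ?_).symm
  rw [Ideal.span_singleton_le_iff_mem, Ideal.mem_comap]
  simpa using hpP

theorem eq_of_natCast_mem_of_natCast_mem {S : Type*} [CommRing S] {p q : ℕ} (hp : p.Prime)
    (hq : q.Prime) {P : Ideal S} [P.IsPrime] (hpP : (p : S) ∈ P) (hqP : (q : S) ∈ P) : p = q := by
  have h := (under_int_eq_span hp hpP).symm.trans (under_int_eq_span hq hqP)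
  rw [Ideal.span_singleton_eq_span_singleton, Int.associated_iff_natAbs] at h
  simpa using h

theorem exists_gal_smul_eq (hK : Module.finrank ℚ K = 2) {p : ℕ} (hp : p.Prime)
    {P Q : Ideal (𝓞 K)} [P.IsPrime] [Q.IsPrime] (hP : (p : 𝓞 K) ∈ P) (hQ : (p : 𝓞 K) ∈ Q) :
    ∃ τ : Gal(K/ℚ), Q = τ • P :=
  have := isGalois_rat_of_finrank_eq_two hK
  Algebra.IsInvariant.exists_smul_of_under_eq ℤ (𝓞 K) Gal(K/ℚ) P Q
    ((under_int_eq_span hp hP).trans (under_int_eq_span hp hQ).symm)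

theorem absNorm_span_natCast_of_finrank_eq_two (hK : Module.finrank ℚ K = 2) (n : ℕ) :
    Ideal.absNorm (Ideal.span {(n : 𝓞 K)}) = n ^ 2 := by
  rw [Ideal.absNorm_span_natCast, RingOfIntegers.rank, hK]

theorem gal_smul_eq_of_sq_eq_span (σ : Gal(K/ℚ)) {n : ℕ} {P : Ideal (𝓞 K)}
    (h : Ideal.span {(n : 𝓞 K)} = P ^ 2) : σ • P = P := by
  have h2 : (σ • P) ^ 2 = P ^ 2 := by
    rw [← smul_pow', ← h, smul_span_natCast]
  exact (pow_left_inj two_ne_zero).mp h2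

/-- A nonzero prime of a quadratic field is inert, or its norm is a rational prime. -/
theorem eq_span_or_mul_gal_smul_eq_span (hK : Module.finrank ℚ K = 2) {σ : Gal(K/ℚ)}
    (hσ : σ ≠ 1) {P : Ideal (𝓞 K)} [P.IsPrime] (hP : P ≠ ⊥) :
    ∃ p : ℕ, p.Prime ∧
      (P = Ideal.span {(p : 𝓞 K)} ∨ P * σ • P = Ideal.span {(p : 𝓞 K)}) := by
  have : P.IsMaximal := Ring.DimensionLEOne.maximalOfPrime hP inferInstance
  obtain ⟨p, n, hn, hpP, hp, hnorm⟩ := Ideal.exists_prime_and_absNorm_eq_pow P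
  refine ⟨p, hp, ?_⟩
  obtain ⟨Q, hQ⟩ : P ∣ Ideal.span {(p : 𝓞 K)} := by
    rwa [Ideal.dvd_iff_le, Ideal.span_singleton_le_iff_mem]
  have hN := congrArg Ideal.absNorm hQ
  rw [absNorm_span_natCast_of_finrank_eq_two hK, map_mul, hnorm] at hN
  obtain rfl | rfl | hn2 : n = 1 ∨ n = 2 ∨ 3 ≤ n := by omega
  · have hQN : Ideal.absNorm Q = p := by
      refine Nat.eq_of_mul_eq_mul_left hp.pos ?_
      linarith
    have hQp : Q.IsPrime := Ideal.isPrime_of_irreducible_absNorm (by rw [hQN]; exact hp)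
    have hpQ : (p : 𝓞 K) ∈ Q := by
      have := Ideal.absNorm_mem Q
      rwa [hQN] at this
    obtain ⟨τ, rfl⟩ := exists_gal_smul_eq hK hp hpP hpQ
    right
    rcases gal_eq_one_or_eq hK hσ τ with rfl | rfl
    · rw [one_smul, ← pow_two] at hQ
      rw [gal_smul_eq_of_sq_eq_span σ hQ, hQ, pow_two]
    · exact hQ.symm
  · have hQN : Ideal.absNorm Q = 1 := by
      refine Nat.eq_of_mul_eq_mul_left (pow_pos hp.pos 2) ?_
      linarith
    rw [Ideal.absNorm_eq_one_iff] at hQN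
    left
    rw [hQ, hQN, Ideal.mul_top]
  · have : p ^ 3 ∣ p ^ 2 := (pow_dvd_pow p hn2).trans ⟨_, hN⟩
    exact absurd ((Nat.pow_dvd_pow_iff_le_right hp.one_lt).mp this) (by norm_num)

theorem exists_mul_gal_smul_eq_span (hK : Module.finrank ℚ K = 2) {σ : Gal(K/ℚ)}
    (hσ : σ ≠ 1) {I : Ideal (𝓞 K)} (hI : I ≠ ⊥) :
    ∃ n : ℕ, n ≠ 0 ∧ I * σ • I = Ideal.span {(n : 𝓞 K)} := by
  induction I using UniqueFactorizationMonoid.induction_on_prime with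
  | h₁ => exact absurd rfl hI
  | h₂ I hI' =>
    obtain rfl : I = ⊤ := by simpa using hI'
    exact ⟨1, one_ne_zero, by simp [← Ideal.one_eq_top]⟩
  | h₃ I P hI' hP ih =>
    obtain ⟨n, hn, h⟩ := ih hI'
    have := Ideal.isPrime_of_prime hP
    obtain ⟨p, hp, h' | h'⟩ := eq_span_or_mul_gal_smul_eq_span hK hσ hP.ne_zero
    · refine ⟨p * p * n, by simp [hp.ne_zero, hn], ?_⟩
      rw [smul_mul', mul_mul_mul_comm, h, h', smul_span_natCast]
      simp [Ideal.span_singleton_mul_span_singleton]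
    · refine ⟨p * n, by simp [hp.ne_zero, hn], ?_⟩
      rw [smul_mul', mul_mul_mul_comm, h, h']
      simp [Ideal.span_singleton_mul_span_singleton]

theorem count_coeIdeal_eq_zero (v : HeightOneSpectrum (𝓞 K)) {I : Ideal (𝓞 K)}
    (h : ¬ v.asIdeal ∣ I) : count K v (I : FractionalIdeal (𝓞 K)⁰ K) = 0 := by
  classical
  have hI : I ≠ 0 := fun h0 => h (h0 ▸ dvd_zero _)
  rw [count_coe K v hI]
  by_contra hne
  have := (Associates.count_ne_zero_iff_dvd hI v.irreducible).mp (by exact_mod_cast hne)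
  exact h this

theorem even_count_span_natCast {v : HeightOneSpectrum (𝓞 K)} {p : ℕ} (hp : p.Prime)
    (hv : Ideal.span {(p : 𝓞 K)} = v.asIdeal ^ 2) {n : ℕ} (hn : n ≠ 0) :
    Even (count K v (Ideal.span {(n : 𝓞 K)} : FractionalIdeal (𝓞 K)⁰ K)) := by
  induction n using Nat.recOnMul with
  | zero => exact absurd rfl hn
  | one => simp [count_one]
  | prime q hq =>
    by_cases hpq : p = q
    · subst hpq
      rw [hv, coeIdeal_pow, count_pow_self]
      simp
    · rw [count_coeIdeal_eq_zero]
      · simp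
      · rw [Ideal.dvd_iff_le, Ideal.span_singleton_le_iff_mem]
        have hpv : (p : 𝓞 K) ∈ v.asIdeal := by
          rw [← Ideal.span_singleton_le_iff_mem, hv]
          exact Ideal.pow_le_self two_ne_zero
        have := v.isPrime
        exact fun hqv => hpq (eq_of_natCast_mem_of_natCast_mem hp hq hpv hqv)
  | mul a b iha ihb =>
    have ha : a ≠ 0 := left_ne_zero_of_mul hn
    have hb : b ≠ 0 := right_ne_zero_of_mul hn
    rw [Nat.cast_mul, ← Ideal.span_singleton_mul_span_singleton, coeIdeal_mul, count_mul]
    · exact (iha ha).add (ihb hb)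
    · exact coeIdeal_ne_zero.mpr (span_natCast_ne_bot ha)
    · exact coeIdeal_ne_zero.mpr (span_natCast_ne_bot hb)

/-- A Galois-invariant ideal with even valuations at the ramified primes is generated by a
rational integer. -/
theorem exists_eq_span_of_gal_smul_eq (hK : Module.finrank ℚ K = 2) {σ : Gal(K/ℚ)}
    (hσ : σ ≠ 1) {I : Ideal (𝓞 K)} (hI : I ≠ ⊥) (hσI : σ • I = I)
    (heven : ∀ v : HeightOneSpectrum (𝓞 K), ∀ p : ℕ, p.Prime →
      Ideal.span {(p : 𝓞 K)} = v.asIdeal ^ 2 → Even (count K v (I : FractionalIdeal (𝓞 K)⁰ K))) :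
    ∃ n : ℕ, n ≠ 0 ∧ I = Ideal.span {(n : 𝓞 K)} := by
  induction hN : Ideal.absNorm I using Nat.strong_induction_on generalizing I with
  | h N ih =>
  by_cases htop : I = ⊤
  · exact ⟨1, one_ne_zero, by simpa using htop⟩
  suffices ∃ p : ℕ, p.Prime ∧ Ideal.span {(p : 𝓞 K)} ∣ I by
    obtain ⟨p, hp, J, rfl⟩ := this
    have hp0 : Ideal.span {(p : 𝓞 K)} ≠ ⊥ := span_natCast_ne_bot hp.ne_zero
    have hJ : J ≠ ⊥ := fun h => hI (by simp [h])
    obtain ⟨n, hn, rfl⟩ := ih (Ideal.absNorm J) (by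
      rw [← hN, map_mul, absNorm_span_natCast_of_finrank_eq_two hK]
      have h1 : 0 < Ideal.absNorm J :=
        Nat.pos_of_ne_zero (Ideal.absNorm_eq_zero_iff.not.mpr hJ)
      have h2 : 1 < p ^ 2 := Nat.one_lt_pow two_ne_zero hp.one_lt
      nlinarith) hJ (by
      rw [smul_mul', smul_span_natCast] at hσI
      exact mul_left_cancel₀ hp0 hσI) (fun v q hq hv => by
      have := heven v q hq hv
      rw [coeIdeal_mul, count_mul _ _ (coeIdeal_ne_zero.mpr hp0) (coeIdeal_ne_zero.mpr hJ),
        Int.even_add] at this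
      exact this.mp (even_count_span_natCast hq hv hp.ne_zero)) rfl
    exact ⟨p * n, mul_ne_zero hp.ne_zero hn, by
      simp [Ideal.span_singleton_mul_span_singleton]⟩
  obtain ⟨P, hPmax, hPI⟩ := Ideal.exists_le_maximal I htop
  rw [← Ideal.dvd_iff_le] at hPI
  have hP : P ≠ ⊥ := by
    rintro rfl
    exact hI (zero_dvd_iff.mp hPI)
  obtain ⟨p, hp, h | h⟩ := eq_span_or_mul_gal_smul_eq_span hK hσ hP
  · exact ⟨p, hp, h ▸ hPI⟩
  refine ⟨p, hp, ?_⟩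
  have hPI' : σ • P ∣ I := by
    rw [Ideal.dvd_iff_le] at hPI ⊢
    rw [← hσI]
    exact Ideal.map_mono hPI
  have hPrime : Prime P := Ideal.prime_of_isPrime hP inferInstance
  by_cases hσP : σ • P = P
  · rw [hσP, ← pow_two] at h
    obtain ⟨J, rfl⟩ := hPI
    rw [← h, pow_two]
    refine mul_dvd_mul_left _ ?_
    let v : HeightOneSpectrum (𝓞 K) := ⟨P, hPmax.isPrime, hP⟩
    by_contra hPJ
    have h1 := heven v p hp h.symm
    rw [coeIdeal_mul, count_mul _ _ (coeIdeal_ne_zero.mpr hP)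
      (coeIdeal_ne_zero.mpr (right_ne_zero_of_mul hI)), count_coeIdeal_eq_zero v hPJ,
      count_self K v] at h1
    exact absurd h1 (by decide)
  · obtain ⟨J, rfl⟩ := hPI'
    rw [← h, mul_comm]
    refine mul_dvd_mul_left _ ((hPrime.dvd_or_dvd hPI).resolve_left fun hd => hσP ?_)
    have : (σ • P).IsPrime := (Ideal.IsPrime.smul_iff σ).mpr hPmax.isPrime
    have hσP0 : σ • P ≠ ⊥ := left_ne_zero_of_mul hI
    exact (Ring.DimensionLEOne.maximalOfPrime hσP0 this).eq_of_le hPmax.ne_top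
      (Ideal.dvd_iff_le.mp hd)

end Ideals

section FractionalIdeals

open scoped Pointwise nonZeroDivisors

open IsDedekindDomain FractionalIdeal

variable {K : Type*} [Field K] [NumberField K]

/-- The action of a Galois automorphism on the group of fractional ideals. -/
noncomputable def galFractionalIdeal (σ : Gal(K/ℚ)) :
    (FractionalIdeal (𝓞 K)⁰ K)ˣ →* (FractionalIdeal (𝓞 K)⁰ K)ˣ :=
  Units.map (extendedHom' (A := 𝓞 K) (M := (𝓞 K)⁰) (K := K) K
    (f := MulSemiringAction.toRingHom Gal(K/ℚ) (𝓞 K) σ)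
    (nonZeroDivisors_le_comap_nonZeroDivisors_of_injective _ (MulAction.injective σ))).toMonoidHom

theorem galFractionalIdeal_toPrincipalIdeal (σ : Gal(K/ℚ)) (x : Kˣ) :
    galFractionalIdeal σ (toPrincipalIdeal (𝓞 K) K x) =
      toPrincipalIdeal (𝓞 K) K (Units.map (σ : K →* K) x) := by
  ext1
  simp only [galFractionalIdeal, Units.coe_map, coe_toPrincipalIdeal, MonoidHom.coe_coe,
    RingHom.toMonoidHom_eq_coe, extendedHom'_apply, extended_spanSingleton]
  congr 1
  refine DFunLike.congr_fun (IsLocalization.ringHom_ext (𝓞 K)⁰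
    (j := IsLocalization.map (S := K) K (MulSemiringAction.toRingHom Gal(K/ℚ) (𝓞 K) σ)
      (nonZeroDivisors_le_comap_nonZeroDivisors_of_injective _ (MulAction.injective σ)))
    (k := (σ : K →+* K)) ?_) (x : K)
  ext y
  simp only [RingHom.comp_apply, IsLocalization.map_eq]
  rfl

theorem coe_galFractionalIdeal (σ : Gal(K/ℚ)) {J : (FractionalIdeal (𝓞 K)⁰ K)ˣ} {I : Ideal (𝓞 K)}
    (h : (J : FractionalIdeal (𝓞 K)⁰ K) = I) :
    (galFractionalIdeal σ J : FractionalIdeal (𝓞 K)⁰ K) = (σ • I : Ideal (𝓞 K)) := by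
  simp only [galFractionalIdeal, Units.coe_map, MonoidHom.coe_coe,
    RingHom.toMonoidHom_eq_coe, extendedHom'_apply, h,
    extended_coeIdeal_eq_map]
  rfl

variable (K) in
/-- The fractional ideals generated by nonzero rational numbers. -/
noncomputable def rationalIdeals : Subgroup (FractionalIdeal (𝓞 K)⁰ K)ˣ :=
  Subgroup.map (toPrincipalIdeal (𝓞 K) K) (Units.map (algebraMap ℚ K : ℚ →* K)).range

variable (K) in
/-- The principal fractional ideals generated by totally positive elements. -/
noncomputable def positivePrincipalIdeals : Subgroup (FractionalIdeal (𝓞 K)⁰ K)ˣ :=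
  Subgroup.map (toPrincipalIdeal (𝓞 K) K) (totallyPositiveUnits K)

/-- The fractional ideals fixed by `σ`. -/
noncomputable def ambiguousIdeals (σ : Gal(K/ℚ)) : Subgroup (FractionalIdeal (𝓞 K)⁰ K)ˣ :=
  (galFractionalIdeal σ).eqLocus (MonoidHom.id _)

theorem toPrincipalIdeal_neg (x : Kˣ) :
    toPrincipalIdeal (𝓞 K) K (-x) = toPrincipalIdeal (𝓞 K) K x := by
  ext1
  rw [coe_toPrincipalIdeal, coe_toPrincipalIdeal, Units.val_neg,
    ← coeToSubmodule_inj, coe_spanSingleton, coe_spanSingleton, ← Set.neg_singleton,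
    Submodule.span_neg]

theorem mem_rationalIdeals_iff {J : (FractionalIdeal (𝓞 K)⁰ K)ˣ} :
    J ∈ rationalIdeals K ↔ ∃ q : ℚˣ, 0 < (q : ℚ) ∧
      toPrincipalIdeal (𝓞 K) K (Units.map (algebraMap ℚ K : ℚ →* K) q) = J := by
  constructor
  · rintro ⟨_, ⟨q, rfl⟩, rfl⟩
    rcases lt_or_gt_of_ne q.ne_zero with h | h
    · refine ⟨-q, by simpa using h, ?_⟩
      rw [← toPrincipalIdeal_neg]
      exact congrArg (toPrincipalIdeal (𝓞 K) K) (Units.ext (by simp))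
    · exact ⟨q, h, rfl⟩
  · rintro ⟨q, -, rfl⟩
    exact ⟨_, ⟨q, rfl⟩, rfl⟩

theorem rationalIdeals_le_positivePrincipalIdeals :
    rationalIdeals K ≤ positivePrincipalIdeals K := by
  intro J hJ
  obtain ⟨q, hq, rfl⟩ := mem_rationalIdeals_iff.mp hJ
  exact ⟨_, algebraMap_mem_totallyPositiveUnits hq, rfl⟩

theorem rationalIdeals_le_ambiguousIdeals (σ : Gal(K/ℚ)) :
    rationalIdeals K ≤ ambiguousIdeals σ := by
  rintro _ ⟨_, ⟨q, rfl⟩, rfl⟩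
  change galFractionalIdeal σ _ = _
  rw [galFractionalIdeal_toPrincipalIdeal]
  exact congrArg (toPrincipalIdeal (𝓞 K) K) (Units.ext (by simp))

theorem mem_rationalIdeals_of_eq_span {J : (FractionalIdeal (𝓞 K)⁰ K)ˣ} {n : ℕ} (hn : n ≠ 0)
    (h : (J : FractionalIdeal (𝓞 K)⁰ K) = Ideal.span {(n : 𝓞 K)}) : J ∈ rationalIdeals K := by
  refine ⟨_, ⟨Units.mk0 (n : ℚ) (by exact_mod_cast hn), rfl⟩, ?_⟩
  ext1
  rw [coe_toPrincipalIdeal, h, coeIdeal_span_singleton]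
  simp

/-- Every fractional ideal is integral up to a rational factor. -/
theorem exists_eq_mul_coeIdeal (J : (FractionalIdeal (𝓞 K)⁰ K)ˣ) :
    ∃ q ∈ rationalIdeals K, ∃ J' : (FractionalIdeal (𝓞 K)⁰ K)ˣ, ∃ I : Ideal (𝓞 K), I ≠ ⊥ ∧
      (J' : FractionalIdeal (𝓞 K)⁰ K) = I ∧ J = q * J' := by
  obtain ⟨a, I, ha, hJ⟩ := exists_eq_spanSingleton_mul (J : FractionalIdeal (𝓞 K)⁰ K)
  have hn : Ideal.absNorm (Ideal.span {a}) ≠ 0 := by simpa [Ideal.absNorm_eq_zero_iff] using ha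
  obtain ⟨b, hb⟩ := Ideal.mem_span_singleton.mp (Ideal.absNorm_mem (Ideal.span {a}))
  generalize Ideal.absNorm (Ideal.span {a}) = n at hn hb
  have hspan : Ideal.span {(n : 𝓞 K)} ≠ ⊥ := span_natCast_ne_bot hn
  let q : (FractionalIdeal (𝓞 K)⁰ K)ˣ := Units.mk0 _ (coeIdeal_ne_zero.mpr hspan)
  have hqJ : ((q * J : (FractionalIdeal (𝓞 K)⁰ K)ˣ) : FractionalIdeal (𝓞 K)⁰ K) =
      (Ideal.span {b} * I : Ideal (𝓞 K)) := by
    have ha' : algebraMap (𝓞 K) K a ≠ 0 := by simpa using ha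
    rw [Units.val_mul, hJ, Units.val_mk0, hb, coeIdeal_mul, coeIdeal_span_singleton,
      coeIdeal_span_singleton, map_mul, ← mul_assoc, spanSingleton_mul_spanSingleton]
    congr 2
    field_simp
  refine ⟨q⁻¹, inv_mem (mem_rationalIdeals_of_eq_span hn rfl), q * J, _, ?_, hqJ, by simp⟩
  intro h0
  rw [h0] at hqJ
  simp at hqJ

theorem mul_galFractionalIdeal_mem (hK : Module.finrank ℚ K = 2) {σ : Gal(K/ℚ)} (hσ : σ ≠ 1)
    (J : (FractionalIdeal (𝓞 K)⁰ K)ˣ) : J * galFractionalIdeal σ J ∈ rationalIdeals K := by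
  obtain ⟨q, hq, J, I, hI, hJ, rfl⟩ := exists_eq_mul_coeIdeal J
  obtain ⟨n, hn, h⟩ := exists_mul_gal_smul_eq_span hK hσ hI
  rw [map_mul, mul_mul_mul_comm]
  refine mul_mem (mul_mem hq ?_) (mem_rationalIdeals_of_eq_span hn ?_)
  · have : galFractionalIdeal σ q = q := rationalIdeals_le_ambiguousIdeals σ hq
    rwa [this]
  · rw [Units.val_mul, coe_galFractionalIdeal σ hJ, hJ, ← coeIdeal_mul, h]

theorem galFractionalIdeal_galFractionalIdeal (hK : Module.finrank ℚ K = 2) {σ : Gal(K/ℚ)}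
    (hσ : σ ≠ 1) (J : (FractionalIdeal (𝓞 K)⁰ K)ˣ) :
    galFractionalIdeal σ (galFractionalIdeal σ J) = J := by
  have h : galFractionalIdeal σ (J * galFractionalIdeal σ J) = J * galFractionalIdeal σ J :=
    rationalIdeals_le_ambiguousIdeals σ (mul_galFractionalIdeal_mem hK hσ J)
  rw [map_mul, mul_comm] at h
  exact mul_right_cancel h

/-- The parities of the valuations of a fractional ideal at a family of primes. -/
noncomputable def parityHom {ι : Type*} (v : ι → HeightOneSpectrum (𝓞 K)) :
    (FractionalIdeal (𝓞 K)⁰ K)ˣ →* (ι → Multiplicative (ZMod 2)) where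
  toFun J i := Multiplicative.ofAdd (count K (v i) (J : FractionalIdeal (𝓞 K)⁰ K) : ZMod 2)
  map_one' := by
    ext i
    simp [count_one]
  map_mul' J J' := by
    ext i
    simp [count_mul K (v i) J.ne_zero J'.ne_zero]

theorem parityHom_apply_eq_one_iff {ι : Type*} {v : ι → HeightOneSpectrum (𝓞 K)}
    {J : (FractionalIdeal (𝓞 K)⁰ K)ˣ} :
    parityHom v J = 1 ↔ ∀ i, Even (count K (v i) (J : FractionalIdeal (𝓞 K)⁰ K)) := by
  simp_rw [← ZMod.intCast_eq_zero_iff_even]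
  exact funext_iff

theorem parityHom_eq_one_of_mem_rationalIdeals {ι : Type*} {v : ι → HeightOneSpectrum (𝓞 K)}
    {p : ι → ℕ} (hp : ∀ i, (p i).Prime)
    (hv : ∀ i, Ideal.span {(p i : 𝓞 K)} = (v i).asIdeal ^ 2)
    {J : (FractionalIdeal (𝓞 K)⁰ K)ˣ} (hJ : J ∈ rationalIdeals K) : parityHom v J = 1 := by
  obtain ⟨q, hq, rfl⟩ := mem_rationalIdeals_iff.mp hJ
  have key (n : ℕ) (hn : n ≠ 0) : parityHom v (Units.mk0 _
      (coeIdeal_ne_zero.mpr (span_natCast_ne_bot (K := K) hn))) = 1 :=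
    parityHom_apply_eq_one_iff.mpr fun i => even_count_span_natCast (hp i) (hv i) hn
  have hnum : (q : ℚ).num.toNat ≠ 0 := by
    have := Rat.num_pos.mpr hq
    omega
  have h : toPrincipalIdeal (𝓞 K) K (Units.map (algebraMap ℚ K : ℚ →* K) q) *
      Units.mk0 _ (coeIdeal_ne_zero.mpr (span_natCast_ne_bot (K := K) (q : ℚ).den_nz)) =
      Units.mk0 _ (coeIdeal_ne_zero.mpr (span_natCast_ne_bot (K := K) hnum)) := by
    ext1
    rw [Units.val_mul, coe_toPrincipalIdeal, Units.val_mk0, Units.val_mk0,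
      coeIdeal_span_singleton, coeIdeal_span_singleton, spanSingleton_mul_spanSingleton]
    congr 1
    have h1 : ((q : ℚ).num.toNat : ℚ) = (q : ℚ) * (q : ℚ).den := by
      rw [Rat.mul_den_eq_num]
      exact_mod_cast Int.toNat_of_nonneg (Rat.num_nonneg.mpr hq.le)
    have h2 := congrArg (algebraMap ℚ K) h1
    rw [map_mul] at h2
    simpa only [map_natCast, Units.coe_map, MonoidHom.coe_coe] using h2.symm
  have := congrArg (parityHom v) h
  rwa [map_mul, key _ hnum, key _ (q : ℚ).den_nz, mul_one] at this

theorem map_parityHom_ambiguousIdeals {ι : Type*} [Finite ι] (σ : Gal(K/ℚ))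
    {v : ι → HeightOneSpectrum (𝓞 K)} (hinj : Function.Injective v)
    {p : ι → ℕ} (hv : ∀ i, Ideal.span {(p i : 𝓞 K)} = (v i).asIdeal ^ 2) :
    (ambiguousIdeals σ).map (parityHom v) = ⊤ := by
  classical
  have := Fintype.ofFinite ι
  rw [eq_top_iff]
  rintro f -
  rw [← Finset.univ_prod_mulSingle f]
  refine prod_mem fun i _ => ?_
  generalize f i = x
  have hx : x = 1 ∨ x = Multiplicative.ofAdd 1 := by
    revert x
    decide
  rcases hx with rfl | rfl
  · rw [Pi.mulSingle_one]
    exact one_mem _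
  · have hne : (v i).asIdeal ≠ ⊥ := (v i).ne_bot
    refine ⟨Units.mk0 _ (coeIdeal_ne_zero.mpr hne), ?_, ?_⟩
    · change galFractionalIdeal σ _ = _
      ext1
      rw [coe_galFractionalIdeal σ (I := (v i).asIdeal) rfl,
        gal_smul_eq_of_sq_eq_span σ (hv i)]
      rfl
    · ext j
      by_cases hij : j = i
      · subst hij
        simp [parityHom, count_self]
      · simp [parityHom, hij, count_maximal_coprime K (v j) (hinj.ne (Ne.symm hij))]

/-- A fixed fractional ideal with even valuations at the ramified primes is rational. -/
theorem ker_parityHom_inf_ambiguousIdeals (hK : Module.finrank ℚ K = 2) {σ : Gal(K/ℚ)}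
    (hσ : σ ≠ 1) {ι : Type*} {v : ι → HeightOneSpectrum (𝓞 K)}
    {p : ι → ℕ} (hp : ∀ i, (p i).Prime)
    (hv : ∀ i, Ideal.span {(p i : 𝓞 K)} = (v i).asIdeal ^ 2)
    (hall : ∀ w : HeightOneSpectrum (𝓞 K), ∀ q : ℕ, q.Prime →
      Ideal.span {(q : 𝓞 K)} = w.asIdeal ^ 2 → ∃ i, v i = w) :
    (parityHom v).ker ⊓ ambiguousIdeals σ = rationalIdeals K := by
  refine le_antisymm ?_ (le_inf (fun J hJ => parityHom_eq_one_of_mem_rationalIdeals hp hv hJ)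
    (rationalIdeals_le_ambiguousIdeals σ))
  rintro J ⟨hJker, hJamb⟩
  obtain ⟨q, hq, J, I, hI, hJ, rfl⟩ := exists_eq_mul_coeIdeal J
  have hamb : J ∈ ambiguousIdeals σ :=
    ((ambiguousIdeals σ).mul_mem_cancel_left (rationalIdeals_le_ambiguousIdeals σ hq)).mp hJamb
  have hpar : parityHom v J = 1 := by
    have h : parityHom v (q * J) = 1 := hJker
    rwa [map_mul, parityHom_eq_one_of_mem_rationalIdeals hp hv hq, one_mul] at h
  refine mul_mem hq ?_
  obtain ⟨n, hn, rfl⟩ := exists_eq_span_of_gal_smul_eq hK hσ hI (by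
    have h1 := coe_galFractionalIdeal σ hJ
    have h2 : galFractionalIdeal σ J = J := hamb
    rw [h2, hJ] at h1
    exact (coeIdeal_injective h1).symm) (fun w q hq hw => by
    obtain ⟨i, rfl⟩ := hall w q hq hw
    exact hJ ▸ parityHom_apply_eq_one_iff.mp hpar i)
  exact mem_rationalIdeals_of_eq_span hn hJ

theorem relIndex_rationalIdeals_ambiguousIdeals (hK : Module.finrank ℚ K = 2) {σ : Gal(K/ℚ)}
    (hσ : σ ≠ 1) (R : Finset ℕ) (hR : ∀ p : ℕ, p ∈ R ↔ IsRamifiedIn K p) :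
    (rationalIdeals K).relIndex (ambiguousIdeals σ) = 2 ^ R.card := by
  have hv (p : R) : ∃ v : HeightOneSpectrum (𝓞 K),
      Ideal.span {((p : ℕ) : 𝓞 K)} = v.asIdeal ^ 2 := by
    obtain ⟨hp, P, hP, h⟩ := (hR p).mp p.2
    refine ⟨⟨P, hP, ?_⟩, h⟩
    rintro rfl
    exact span_natCast_ne_bot hp.ne_zero (h.trans (by simp))
  choose v hv using hv
  have hp (p : R) : (p : ℕ).Prime := ((hR p).mp p.2).1
  have hmem {p : ℕ} {w : HeightOneSpectrum (𝓞 K)}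
      (h : Ideal.span {(p : 𝓞 K)} = w.asIdeal ^ 2) : (p : 𝓞 K) ∈ w.asIdeal := by
    rw [← Ideal.span_singleton_le_iff_mem, h]
    exact Ideal.pow_le_self two_ne_zero
  have hinj : Function.Injective v := fun a b hab => Subtype.ext <|
    have := (v a).isPrime
    eq_of_natCast_mem_of_natCast_mem (hp a) (hp b) (hmem (hv a)) (hab ▸ hmem (hv b))
  rw [← ker_parityHom_inf_ambiguousIdeals hK hσ hp hv fun w q hq hw =>
    ⟨⟨q, (hR q).mpr ⟨hq, _, w.isPrime, hw⟩⟩, HeightOneSpectrum.ext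
      ((pow_left_inj two_ne_zero).mp ((hv _).symm.trans hw))⟩,
    Subgroup.inf_relIndex_right, Subgroup.relIndex_ker,
    map_parityHom_ambiguousIdeals σ hinj hv, Subgroup.card_top]
  simp

end FractionalIdeals

section Units

open scoped nonZeroDivisors

open FractionalIdeal

variable {K : Type*} [Field K] [NumberField K]

/-- The squares have index two in a cyclic group without odd exponent. -/
theorem index_range_powMonoidHom_two {G : Type*} [CommGroup G] [IsCyclic G]
    (h : ∀ k : ℤ, Odd k → ∃ z : G, z ^ k ≠ 1) : (powMonoidHom 2 : G →* G).range.index = 2 := by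
  obtain ⟨g, hg⟩ := IsCyclic.exists_generator (α := G)
  have key (k : ℤ) : g ^ k ∈ (powMonoidHom 2 : G →* G).range ↔ Even k := by
    constructor
    · rintro ⟨x, hx⟩
      obtain ⟨m, rfl⟩ := hg x
      by_contra hk
      rw [Int.not_even_iff_odd] at hk
      obtain ⟨z, hz⟩ := h (k - m * 2) (hk.sub_even (even_two.mul_left m))
      obtain ⟨n, rfl⟩ := hg z
      refine hz ?_
      have hgk : g ^ (k - m * 2) = 1 := by
        rw [zpow_sub, zpow_mul, ← hx, mul_inv_eq_one]
        exact (zpow_ofNat _ 2).symm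
      change (g ^ n) ^ (k - m * 2) = 1
      rw [zpow_comm, hgk, one_zpow]
    · rintro ⟨m, rfl⟩
      exact ⟨g ^ m, by rw [powMonoidHom_apply, zpow_add, pow_two]⟩
  rw [Subgroup.index_eq_two_iff]
  refine ⟨g, fun b => ?_⟩
  obtain ⟨m, rfl⟩ := hg b
  change Xor (g ^ m * g ∈ _) (g ^ m ∈ _)
  rw [← zpow_add_one, key, key, Int.even_add_one]
  by_cases hm : Even m <;> simp [hm]

variable (K) in
/-- The totally positive units of the ring of integers. -/
noncomputable def positiveUnits : Subgroup (𝓞 K)ˣ :=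
  (totallyPositiveUnits K).comap (Units.map (algebraMap (𝓞 K) K : 𝓞 K →* K))

theorem map_positiveUnits : (positiveUnits K).map (Units.map (algebraMap (𝓞 K) K : 𝓞 K →* K)) =
    totallyPositiveUnits K ⊓ (toPrincipalIdeal (𝓞 K) K).ker := by
  rw [positiveUnits, Subgroup.map_comap_eq, inf_comm]
  congr 1
  ext x
  rw [MonoidHom.mem_ker, Units.ext_iff, coe_toPrincipalIdeal, Units.val_one, ← spanSingleton_one,
    spanSingleton_eq_spanSingleton, MonoidHom.mem_range]
  constructor
  · rintro ⟨u, rfl⟩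
    exact ⟨u⁻¹, by simp [Units.smul_def, Algebra.smul_def]⟩
  · rintro ⟨u, hu⟩
    refine ⟨u⁻¹, ?_⟩
    rw [map_inv, inv_eq_iff_mul_eq_one]
    ext
    simpa [Units.smul_def, Algebra.smul_def] using hu

theorem mul_gal_eq_one (hK : Module.finrank ℚ K = 2) {σ : Gal(K/ℚ)} (hσ : σ ≠ 1) {y : Kˣ}
    (hy : y ∈ totallyPositiveUnits K)
    (h : toPrincipalIdeal (𝓞 K) K (y * Units.map (σ : K →* K) y) = 1) : (y : K) * σ y = 1 := by
  obtain ⟨q, hq⟩ := exists_algebraMap_eq_of_gal_apply_eq hK hσ (x := y * σ y)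
    (by rw [map_mul, gal_apply_apply hK, mul_comm])
  have hpos := pos_of_mul_gal_eq hK hσ hy hq
  obtain ⟨u, -, hu⟩ : y * Units.map (σ : K →* K) y ∈
      (positiveUnits K).map (Units.map (algebraMap (𝓞 K) K : 𝓞 K →* K)) := by
    rw [map_positiveUnits]
    exact ⟨mul_mem hy (gal_mem_totallyPositiveUnits hy σ), h⟩
  have hu1 : algebraMap (𝓞 K) K u = algebraMap ℚ K q :=
    (congrArg Units.val hu).trans hq.symm
  have hint (r : ℚ) (v : 𝓞 K) (hv : algebraMap (𝓞 K) K v = algebraMap ℚ K r) :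
      ∃ n : ℤ, (n : ℚ) = r :=
    IsIntegrallyClosed.isIntegral_iff.mp ((isIntegral_algebraMap_iff
      (algebraMap ℚ K).injective).mp (hv ▸ RingOfIntegers.isIntegral_coe v))
  obtain ⟨n, rfl⟩ := hint q u hu1
  obtain ⟨m, hm⟩ := hint ((n : ℚ)⁻¹) (u⁻¹ : (𝓞 K)ˣ) (by
    rw [map_inv₀, ← hu1, ← mul_eq_one_iff_eq_inv₀ (by simp), ← map_mul, Units.inv_mul, map_one])
  have hn : 0 < n := by exact_mod_cast hpos
  have hmn : n * m = 1 := by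
    have : (n : ℚ) * m = 1 := by rw [hm, mul_inv_cancel₀ hpos.ne']
    exact_mod_cast this
  rw [← hq, Int.eq_one_or_neg_one_of_mul_eq_one hmn |>.resolve_right (by omega)]
  simp

set_option maxSynthPendingDepth 3 in
theorem isCyclic_positiveUnits (hK : Module.finrank ℚ K = 2) :
    IsCyclic (positiveUnits K) ∧ ∀ k : ℤ, Odd k → ∃ z : positiveUnits K, z ^ k ≠ 1 := by
  have h1 := InfinitePlace.card_add_two_mul_card_eq_rank K
  have h2 := InfinitePlace.card_eq_nrRealPlaces_add_nrComplexPlaces K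
  have h3 := Units.finrank_modTorsion K
  rw [Units.rank] at h3
  rcases (by omega : InfinitePlace.nrRealPlaces K = 0 ∨ InfinitePlace.nrRealPlaces K = 2) with h | h
  · have : IsTotallyComplex K := nrRealPlaces_eq_zero_iff.mp h
    have htop : Units.torsion K = ⊤ := by
      have h4 : Module.finrank ℤ (Additive ((𝓞 K)ˣ ⧸ Units.torsion K)) = 0 := by omega
      rw [Module.finrank_zero_iff] at h4
      have : Subsingleton ((𝓞 K)ˣ ⧸ Units.torsion K) := h4
      rwa [QuotientGroup.subsingleton_iff] at this
    have : IsCyclic (𝓞 K)ˣ := by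
      have : IsCyclic (⊤ : Subgroup (𝓞 K)ˣ) := htop ▸ inferInstance
      exact isCyclic_of_surjective _ (Subgroup.topEquiv (G := (𝓞 K)ˣ)).surjective
    have hφ (φ : K →+* ℝ) : False := by
      refine IsTotallyComplex.complexEmbedding_not_isReal (Complex.ofRealHom.comp φ) ?_
      ext x
      simp
    refine ⟨inferInstance, fun k hk => ⟨⟨-1, fun φ => (hφ φ).elim⟩, fun hz => ?_⟩⟩
    have h5 : (-1 : (𝓞 K)ˣ) ^ k = 1 := congrArg Subtype.val hz
    rw [hk.neg_one_zpow, Units.ext_iff, Units.val_neg, Units.val_one] at h5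
    exact Ring.neg_one_ne_one_of_char_ne_two (by simp [ringChar.eq_zero]) h5
  · obtain ⟨w, hw⟩ : ∃ w : InfinitePlace K, w.IsReal := by
      by_contra! hw
      have := nrRealPlaces_eq_zero_iff.mpr
        ⟨fun v => InfinitePlace.not_isReal_iff_isComplex.mp (hw v)⟩
      omega
    let φ : K →+* ℝ := InfinitePlace.embedding_of_isReal hw
    have h4 : Module.finrank ℤ (Additive ((𝓞 K)ˣ ⧸ Units.torsion K)) = 1 := by omega
    constructor
    · have hcyc : IsCyclic ((𝓞 K)ˣ ⧸ Units.torsion K) := by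
        obtain ⟨v, -, hv⟩ := finrank_eq_one_iff'.mp h4
        exact ⟨v.toMul, fun x => (hv (Additive.ofMul x)).imp fun n hn => hn⟩
      refine isCyclic_of_injective ((QuotientGroup.mk' (Units.torsion K)).comp
        (positiveUnits K).subtype) ?_
      rw [injective_iff_map_eq_one]
      rintro ⟨x, hx⟩ hx1
      have hxt : x ∈ Units.torsion K := (QuotientGroup.eq_one_iff x).mp hx1
      rw [Units.torsion, CommGroup.mem_torsion, isOfFinOrder_iff_pow_eq_one] at hxt
      obtain ⟨n, hn, hxn⟩ := hxt
      have hpos : 0 < φ x := hx φ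
      have hφ : φ x ^ n = 1 := by
        simpa using congrArg (fun y : (𝓞 K)ˣ => φ y) hxn
      have := (pow_eq_one_iff_of_nonneg hpos.le hn.ne').mp hφ
      refine Subtype.ext (Units.ext (RingOfIntegers.ext (φ.injective ?_)))
      simpa using this
    · obtain ⟨u, hu⟩ : ∃ u : (𝓞 K)ˣ, u ∉ Units.torsion K := by
        by_contra! hall
        have : Subsingleton ((𝓞 K)ˣ ⧸ Units.torsion K) :=
          QuotientGroup.subsingleton_iff.mpr (Subgroup.eq_top_iff' _ |>.mpr hall)
        have : Subsingleton (Additive ((𝓞 K)ˣ ⧸ Units.torsion K)) := this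
        rw [Module.finrank_zero_of_subsingleton] at h4
        exact zero_ne_one h4
      refine fun k hk => ⟨⟨u ^ 2, fun ψ => ?_⟩, fun hz => hu ?_⟩
      · have : ψ ((u : 𝓞 K) : K) ≠ 0 := by simp
        simpa using sq_pos_iff.mpr this
      · rw [Units.torsion, CommGroup.mem_torsion, isOfFinOrder_iff_zpow_eq_one]
        refine ⟨2 * k, by obtain ⟨m, rfl⟩ := hk; omega, ?_⟩
        rw [zpow_mul, zpow_ofNat]
        exact congrArg Subtype.val hz

/-- The squares have index two in the group of totally positive units. -/
theorem relIndex_sq_positiveUnits (hK : Module.finrank ℚ K = 2) :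
    ((totallyPositiveUnits K ⊓ (toPrincipalIdeal (𝓞 K) K).ker).map (powMonoidHom 2)).relIndex
      (totallyPositiveUnits K ⊓ (toPrincipalIdeal (𝓞 K) K).ker) = 2 := by
  obtain ⟨h1, h2⟩ := isCyclic_positiveUnits hK
  have hinj : Function.Injective (Units.map (algebraMap (𝓞 K) K : 𝓞 K →* K)) :=
    Units.map_injective (FaithfulSMul.algebraMap_injective (𝓞 K) K)
  have hcomm : (powMonoidHom 2).comp (Units.map (algebraMap (𝓞 K) K : 𝓞 K →* K)) =
      (Units.map (algebraMap (𝓞 K) K : 𝓞 K →* K)).comp (powMonoidHom 2) := by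
    ext x
    simp
  rw [← map_positiveUnits, Subgroup.map_map, hcomm, ← Subgroup.map_map,
    Subgroup.relIndex_map_map_of_injective _ _ hinj, Subgroup.relIndex,
    Subgroup.subgroupOf_map_powMonoidHom_eq_range]
  exact index_range_powMonoidHom_two h2

end Units

section GenusTheory

variable {K : Type*} [Field K] [NumberField K]

open scoped nonZeroDivisors

/-- The totally positive generators of the ideals fixed by `σ`. -/
noncomputable def ambiguousGenerators (σ : Gal(K/ℚ)) : Subgroup Kˣ :=
  totallyPositiveUnits K ⊓ (ambiguousIdeals σ).comap (toPrincipalIdeal (𝓞 K) K)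

theorem map_ambiguousGenerators (σ : Gal(K/ℚ)) :
    (ambiguousGenerators σ).map (toPrincipalIdeal (𝓞 K) K) =
      positivePrincipalIdeals K ⊓ ambiguousIdeals σ := by
  ext J
  constructor
  · rintro ⟨x, hx, rfl⟩
    exact ⟨⟨x, hx.1, rfl⟩, hx.2⟩
  · rintro ⟨⟨x, hx, rfl⟩, hJ⟩
    exact ⟨x, ⟨hx, hJ⟩, rfl⟩

theorem toPrincipalIdeal_divGal (σ : Gal(K/ℚ)) (x : Kˣ) :
    toPrincipalIdeal (𝓞 K) K (divGal σ x) =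
      toPrincipalIdeal (𝓞 K) K x / galFractionalIdeal σ (toPrincipalIdeal (𝓞 K) K x) := by
  rw [galFractionalIdeal_toPrincipalIdeal, ← map_div]
  rfl

theorem mem_ambiguousGenerators_iff {σ : Gal(K/ℚ)} {x : Kˣ} :
    x ∈ ambiguousGenerators σ ↔
      x ∈ totallyPositiveUnits K ∧ toPrincipalIdeal (𝓞 K) K (divGal σ x) = 1 := by
  rw [toPrincipalIdeal_divGal, div_eq_one, eq_comm]
  rfl

theorem divGal_mem_totallyPositiveUnits {σ : Gal(K/ℚ)} {x : Kˣ}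
    (hx : x ∈ totallyPositiveUnits K) : divGal σ x ∈ totallyPositiveUnits K :=
  div_mem hx (gal_mem_totallyPositiveUnits hx σ)

/-- Hilbert 90 for totally positive units. -/
theorem map_divGal_ambiguousGenerators (hK : Module.finrank ℚ K = 2) {σ : Gal(K/ℚ)}
    (hσ : σ ≠ 1) : (ambiguousGenerators σ).map (divGal σ) =
      totallyPositiveUnits K ⊓ (toPrincipalIdeal (𝓞 K) K).ker := by
  ext u
  constructor
  · rintro ⟨x, hx, rfl⟩
    obtain ⟨hx, hx1⟩ := mem_ambiguousGenerators_iff.mp hx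
    exact ⟨divGal_mem_totallyPositiveUnits hx, hx1⟩
  · rintro ⟨hu, hu1 : _ = _⟩
    obtain ⟨a, ha, rfl⟩ := exists_divGal_eq hK hσ hu (mul_gal_eq_one hK hσ hu (by
      rw [map_mul, ← galFractionalIdeal_toPrincipalIdeal, hu1, map_one, mul_one]))
    exact ⟨a, mem_ambiguousGenerators_iff.mpr ⟨ha, hu1⟩, rfl⟩

theorem comap_divGal_inf_ambiguousGenerators (hK : Module.finrank ℚ K = 2) {σ : Gal(K/ℚ)}
    (hσ : σ ≠ 1) :
    ((totallyPositiveUnits K ⊓ (toPrincipalIdeal (𝓞 K) K).ker).map (powMonoidHom 2)).comap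
        (divGal σ) ⊓ ambiguousGenerators σ =
      (rationalIdeals K).comap (toPrincipalIdeal (𝓞 K) K) ⊓ ambiguousGenerators σ := by
  have hsq {u : Kˣ} (hu : u ∈ totallyPositiveUnits K) (hu1 : toPrincipalIdeal (𝓞 K) K u = 1) :
      divGal σ u = u ^ 2 := by
    have h := mul_gal_eq_one hK hσ hu (by
      rw [map_mul, ← galFractionalIdeal_toPrincipalIdeal, hu1, map_one, mul_one])
    rw [divGal_eq_iff, Units.val_pow_eq_pow_val, pow_two, mul_assoc, h, mul_one]
  ext x
  simp only [Subgroup.mem_inf, Subgroup.mem_comap, and_congr_left_iff]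
  intro hx
  obtain ⟨hx, -⟩ := mem_ambiguousGenerators_iff.mp hx
  constructor
  · rintro ⟨u, ⟨hu, hu1 : _ = _⟩, hux⟩
    rw [powMonoidHom_apply, ← hsq hu hu1] at hux
    have hfix : σ ((x / u : Kˣ) : K) = (x / u : Kˣ) := by
      have h : divGal σ (x / u) = 1 := by rw [map_div, hux, div_self']
      rw [divGal_eq_iff, Units.val_one, one_mul] at h
      exact h.symm
    obtain ⟨q, hq⟩ := exists_algebraMap_eq_of_gal_apply_eq hK hσ hfix
    have hq0 : q ≠ 0 := by
      rintro rfl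
      exact (x / u).ne_zero (by rw [← hq, map_zero])
    refine ⟨_, ⟨Units.mk0 q hq0, rfl⟩, ?_⟩
    rw [show Units.map (algebraMap ℚ K : ℚ →* K) (Units.mk0 q hq0) = x / u from Units.ext hq,
      map_div, hu1, div_one]
  · intro hxq
    obtain ⟨q, hq, hqx⟩ := mem_rationalIdeals_iff.mp hxq
    set y := Units.map (algebraMap ℚ K : ℚ →* K) q with hy
    have hy1 : divGal σ y = 1 := by
      rw [divGal_eq_iff]
      simp [hy]
    have hu : x / y ∈ totallyPositiveUnits K :=
      div_mem hx (algebraMap_mem_totallyPositiveUnits hq)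
    have hu1 : toPrincipalIdeal (𝓞 K) K (x / y) = 1 := by rw [map_div, hqx, div_self']
    exact ⟨x / y, ⟨hu, hu1⟩, (hsq hu hu1).symm.trans (by rw [map_div, hy1, div_one])⟩

theorem relIndex_rationalIdeals_positivePrincipalIdeals (hK : Module.finrank ℚ K = 2)
    {σ : Gal(K/ℚ)} (hσ : σ ≠ 1) :
    (rationalIdeals K).relIndex (positivePrincipalIdeals K ⊓ ambiguousIdeals σ) = 2 := by
  rw [← map_ambiguousGenerators, ← Subgroup.relIndex_comap, ← Subgroup.inf_relIndex_right,
    ← comap_divGal_inf_ambiguousGenerators hK hσ, Subgroup.inf_relIndex_right,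
    Subgroup.relIndex_comap, map_divGal_ambiguousGenerators hK hσ, relIndex_sq_positiveUnits hK]

/-- The narrow class of a fractional ideal. -/
noncomputable def narrowClass : (FractionalIdeal (𝓞 K)⁰ K)ˣ →* narrowClassGroup K :=
  QuotientGroup.mk' (positivePrincipalIdeals K)

theorem narrowClass_surjective : Function.Surjective (narrowClass (K := K)) :=
  QuotientGroup.mk'_surjective (positivePrincipalIdeals K)

theorem ker_narrowClass : (narrowClass (K := K)).ker = positivePrincipalIdeals K :=
  QuotientGroup.ker_mk' (positivePrincipalIdeals K)

theorem mem_twoTorsion_iff {G : Type*} [CommGroup G] {x : G} : x ∈ twoTorsion G ↔ x ^ 2 = 1 :=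
  Iff.rfl

/-- A class of order dividing two contains an ideal fixed by `σ`. -/
theorem twoTorsion_narrowClassGroup_eq (hK : Module.finrank ℚ K = 2) {σ : Gal(K/ℚ)}
    (hσ : σ ≠ 1) : twoTorsion (narrowClassGroup K) =
      (ambiguousIdeals σ).map narrowClass := by
  ext c
  constructor
  · obtain ⟨J, rfl⟩ := narrowClass_surjective c
    intro hJ
    rw [mem_twoTorsion_iff, ← map_pow, ← MonoidHom.mem_ker, ker_narrowClass] at hJ
    obtain ⟨x, hx, hxJ⟩ := hJ
    obtain ⟨q, hq, hqJ⟩ := mem_rationalIdeals_iff.mp (mul_galFractionalIdeal_mem hK hσ J)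
    set y := x / Units.map (algebraMap ℚ K : ℚ →* K) q with hy
    have hyp : y ∈ totallyPositiveUnits K :=
      div_mem hx (algebraMap_mem_totallyPositiveUnits hq)
    have hyJ : toPrincipalIdeal (𝓞 K) K y = J / galFractionalIdeal σ J := by
      rw [hy, map_div, hxJ, hqJ, pow_two, mul_div_mul_left_eq_div]
    obtain ⟨a, ha, hay⟩ := exists_divGal_eq hK hσ hyp (mul_gal_eq_one hK hσ hyp (by
      rw [map_mul, ← galFractionalIdeal_toPrincipalIdeal, hyJ, map_div,
        galFractionalIdeal_galFractionalIdeal hK hσ, div_mul_div_cancel, div_self']))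
    rw [← hay, toPrincipalIdeal_divGal, div_eq_div_iff_div_eq_div] at hyJ
    refine ⟨J / toPrincipalIdeal (𝓞 K) K a, ?_, ?_⟩
    · change galFractionalIdeal σ _ = J / _
      rw [map_div, ← inv_inj, inv_div, inv_div, hyJ]
    · rw [map_div, div_eq_self, ← MonoidHom.mem_ker, ker_narrowClass]
      exact ⟨a, ha, rfl⟩
  · rintro ⟨J, hJ, rfl⟩
    change galFractionalIdeal σ J = J at hJ
    have h := mul_galFractionalIdeal_mem hK hσ J
    rw [hJ, ← pow_two] at h
    rw [mem_twoTorsion_iff, ← map_pow, ← MonoidHom.mem_ker, ker_narrowClass]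
    exact rationalIdeals_le_positivePrincipalIdeals h

theorem two_mul_card_twoTorsion (hK : Module.finrank ℚ K = 2)
    (R : Finset ℕ) (hR : ∀ p : ℕ, p ∈ R ↔ IsRamifiedIn K p) :
    2 * Nat.card (twoTorsion (narrowClassGroup K)) = 2 ^ R.card := by
  obtain ⟨σ, hσ⟩ := exists_gal_ne_one hK
  have hcard : Nat.card (twoTorsion (narrowClassGroup K)) =
      (positivePrincipalIdeals K ⊓ ambiguousIdeals σ).relIndex (ambiguousIdeals σ) := by
    rw [twoTorsion_narrowClassGroup_eq hK hσ, Subgroup.inf_relIndex_right,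
      ← ker_narrowClass, Subgroup.relIndex_ker]
  rw [hcard, ← relIndex_rationalIdeals_ambiguousIdeals hK hσ R hR,
    ← relIndex_rationalIdeals_positivePrincipalIdeals hK hσ]
  exact Subgroup.relIndex_mul_relIndex _ _ _
    (le_inf rationalIdeals_le_positivePrincipalIdeals (rationalIdeals_le_ambiguousIdeals σ))
    inf_le_right

theorem nonempty_twoTorsion_mulEquiv {G : Type*} [CommGroup G] {n : ℕ}
    (h : Nat.card (twoTorsion G) = 2 ^ n) :
    Nonempty (twoTorsion G ≃* Multiplicative (Fin n → ZMod 2)) := by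
  have : Finite (twoTorsion G) := Nat.finite_of_card_ne_zero (by rw [h]; positivity)
  let _ : Module (ZMod 2) (Additive (twoTorsion G)) :=
    AddCommGroup.zmodModule fun x => congrArg Additive.ofMul (Subtype.ext x.toMul.2)
  have hrank : Module.finrank (ZMod 2) (Additive (twoTorsion G)) = n := by
    refine Nat.pow_right_injective le_rfl ?_
    have h1 := Module.natCard_eq_pow_finrank (K := ZMod 2) (V := Additive (twoTorsion G))
    rw [Nat.card_zmod] at h1
    exact h1.symm.trans h
  let e : Additive (twoTorsion G) ≃ₗ[ZMod 2] (Fin n → ZMod 2) :=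
    LinearEquiv.ofFinrankEq _ _ (by rw [hrank, Module.finrank_fin_fun])
  exact ⟨AddEquiv.toMultiplicativeRight e.toAddEquiv⟩

end GenusTheory

/-- **Gauss' genus theorem.** If `K` is a quadratic field ramified at exactly `r`
rational primes, then the 2-torsion of the narrow class group is `(ℤ/2)^(r-1)`. -/
theorem gauss_genus_theorem (K : Type*) [Field K] [NumberField K]
    (hK : Module.finrank ℚ K = 2)
    (R : Finset ℕ) (hR : ∀ p : ℕ, p ∈ R ↔ IsRamifiedIn K p)
    (r : ℕ) (hr : R.card = r) :
    Nonempty (twoTorsion (narrowClassGroup K) ≃* Multiplicative (Fin (r - 1) → ZMod 2)) := by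
  subst hr
  refine nonempty_twoTorsion_mulEquiv (Nat.eq_of_mul_eq_mul_left two_pos ?_)
  have h := two_mul_card_twoTorsion hK R hR
  rw [h, mul_pow_sub_one]
  rintro h0
  rw [h0, pow_zero] at h
  omega
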